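/- Let K, K_1, …, K_n be fields with each K_i/K separable algebraic and ⋂_{i=1}^n K_i = K, and let (φ : G(K) → A, ψ : B → A, B_1, …, B_n) be a finite embedding problem for (G(K), G(K_1), …, G(K_n)). Then there are fields L, L_1, …, L_n such that: (a) L/K has positive finite transcendence degree; (b) each L_i/L is separable algebraic and ⋂_{i=1}^n L_i = L; (c) K_i ⊆ L_i and the restriction map res : G(L_i) → G(K_i) is bijective for i = 1, …, n; (d) there is a continuous epimorphism γ : G(L) → B with ψ ∘ γ = φ ∘ res_{L_s/K_s} and γ(G(L_i)) = B_i for i = 1, …, n. -/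

import Mathlib

namespace Stmt17

/-- Spherical completeness of Hahn series fields. -/
theorem hahn_spherical {k : Type*} [Field k] (c : Set (HahnSeries ℝ k)) (δ : HahnSeries ℝ k → ℝ)
    (hc : ∀ a ∈ c, ∀ b ∈ c, ∀ g, g < δ a → g < δ b → a.coeff g = b.coeff g) :
    ∃ x : HahnSeries ℝ k, ∀ a ∈ c, ∀ g, g < δ a → x.coeff g = a.coeff g := by
  classical
  let f : ℝ → k := fun g => if h : ∃ a ∈ c, g < δ a then h.choose.coeff g else 0
  have hf : ∀ a ∈ c, ∀ g, g < δ a → f g = a.coeff g := by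
    intro a ha g hg
    have h : ∃ a ∈ c, g < δ a := ⟨a, ha, hg⟩
    simp only [f, dif_pos h]
    exact hc _ h.choose_spec.1 _ ha g h.choose_spec.2 hg
  have hf0 : ∀ g, f g ≠ 0 → ∃ a ∈ c, g < δ a := by
    intro g hg
    by_contra h
    exact hg (by simp only [f, dif_neg h])
  refine ⟨⟨f, ?_⟩, hf⟩
  rw [Set.isPWO_iff_isWF, Set.isWF_iff_no_descending_seq]
  intro s hs hmem
  obtain ⟨a, ha, hlt⟩ := hf0 (s 0) (hmem 0)
  have hwf := a.isWF_support
  rw [Set.isWF_iff_no_descending_seq] at hwf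
  refine hwf s hs (fun n => ?_)
  have hn : s n < δ a := lt_of_le_of_lt (hs.antitone (Nat.zero_le n)) hlt
  have := hmem n
  rw [Function.mem_support, hf a ha _ hn] at this
  exact this

open Polynomial in
theorem hahn_step {k : Type*} [Field k] [IsAlgClosed k] (P : (HahnSeries ℝ k)[X])
    (hP : P.natDegree ≠ 0) (a : HahnSeries ℝ k) (ha : P.eval a ≠ 0) :
    ∃ δ : ℝ, (∀ y : HahnSeries ℝ k, (δ : WithTop ℝ) ≤ y.orderTop →
        (P.eval a).orderTop ≤ (P.eval (a + y)).orderTop) ∧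
      ∃ y : HahnSeries ℝ k, (δ : WithTop ℝ) ≤ y.orderTop ∧
        (P.eval a).orderTop < (P.eval (a + y)).orderTop := by
  classical
  set c : ℕ → HahnSeries ℝ k := fun i => (taylor a P).coeff i with hcdef
  set d := P.natDegree with hd
  have hc0 : c 0 = P.eval a := by simp [hcdef]
  have heval : ∀ y, P.eval (a + y) = ∑ i ∈ Finset.range (d + 1), c i * y ^ i := by
    intro y
    have h1 : P.eval (a + y) = (taylor a P).eval y := by
      rw [taylor_eval, add_comm]
    rw [h1, eval_eq_sum_range, natDegree_taylor]
  have hcd : c d ≠ 0 := by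
    have : c d = P.leadingCoeff := by
      have := leadingCoeff_taylor a P
      rw [← this, leadingCoeff, natDegree_taylor]
    rw [this, leadingCoeff_ne_zero]
    rintro rfl
    simp at hd
    exact hP hd
  set v := (P.eval a).order with hv
  have hvt : (P.eval a).orderTop = (v : WithTop ℝ) := (HahnSeries.order_eq_orderTop_of_ne_zero ha).symm
  let S := (Finset.Icc 1 d).filter (fun i => c i ≠ 0)
  have hS : S.Nonempty := ⟨d, by simp [S, hcd]; omega⟩
  obtain ⟨m, hmS, hm⟩ := S.exists_max_image (fun i => (v - (c i).order) / i) hS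
  set δ : ℝ := (v - (c m).order) / m with hδ
  have hbd : ∀ i ≤ d, ((v - i * δ : ℝ) : WithTop ℝ) ≤ (c i).orderTop := by
    intro i hi
    by_cases h0 : i = 0
    · subst h0; rw [hc0, hvt]; simp
    by_cases hci : c i = 0
    · simp [hci]
    rw [← HahnSeries.order_eq_orderTop_of_ne_zero hci]
    have := hm i (by simp [S, hci]; omega)
    have hi0 : (0 : ℝ) < i := by positivity
    rw [div_le_iff₀ hi0] at this
    norm_cast
    push_cast
    linarith
  have hterm : ∀ y : HahnSeries ℝ k, (δ : WithTop ℝ) ≤ y.orderTop → ∀ i ≤ d,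
      (v : WithTop ℝ) ≤ (c i * y ^ i).orderTop := by
    intro y hy i hi
    have h1 : ((i * δ : ℝ) : WithTop ℝ) ≤ (y ^ i).orderTop := by
      refine le_trans ?_ HahnSeries.orderTop_nsmul_le_orderTop_pow
      refine le_trans ?_ (nsmul_le_nsmul_right hy i)
      rw [← WithTop.coe_nsmul]; simp
    rw [HahnSeries.orderTop_mul]
    refine le_trans ?_ (add_le_add (hbd i hi) h1)
    rw [← WithTop.coe_add]; simp
  have hge : ∀ y : HahnSeries ℝ k, (δ : WithTop ℝ) ≤ y.orderTop →
      (v : WithTop ℝ) ≤ (P.eval (a + y)).orderTop := by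
    intro y hy
    rw [heval, HahnSeries.le_orderTop_iff_forall]
    intro g hg
    rw [HahnSeries.coeff_sum]
    refine Finset.sum_eq_zero fun i hi => ?_
    exact HahnSeries.coeff_eq_zero_of_lt_orderTop
      (lt_of_lt_of_le hg (hterm y hy i (by simp at hi; omega)))
  refine ⟨δ, by rw [hvt]; exact hge, ?_⟩
  let q : k[X] := ∑ i ∈ Finset.range (d + 1), monomial i ((c i).coeff (v - i * δ))
  have hqc : ∀ j ≤ d, q.coeff j = (c j).coeff (v - j * δ) := by
    intro j hj
    simp only [q, finsetSum_coeff, coeff_monomial]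
    rw [Finset.sum_ite_eq' ]
    simp; omega
  simp only [S, Finset.mem_filter, Finset.mem_Icc] at hmS
  have hqm : q.coeff m ≠ 0 := by
    rw [hqc m hmS.1.2]
    have : v - m * δ = (c m).order := by
      have : (m : ℝ) ≠ 0 := by have := hmS.1.1; positivity
      rw [hδ]; field_simp; ring
    rw [this, ne_eq, HahnSeries.coeff_order_eq_zero]
    exact hmS.2
  have hqdeg : q.degree ≠ 0 := by
    intro h
    have : m = 0 := by
      have h1 := le_natDegree_of_ne_zero hqm
      have h2 := natDegree_eq_zero_iff_degree_le_zero.2 h.le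
      omega
    omega
  obtain ⟨z, hz⟩ := IsAlgClosed.exists_root q hqdeg
  have hy : (δ : WithTop ℝ) ≤ (HahnSeries.single δ z).orderTop := HahnSeries.orderTop_single_le
  refine ⟨HahnSeries.single δ z, hy, ?_⟩
  rw [hvt]
  refine lt_of_le_of_ne (hge _ hy) (fun h => ?_)
  have h2 := HahnSeries.coeff_orderTop_ne h.symm
  apply h2
  rw [heval, HahnSeries.coeff_sum]
  rw [IsRoot.def] at hz
  rw [← hz, eval_finsetSum]
  refine Finset.sum_congr rfl fun i hi => ?_
  rw [HahnSeries.single_pow, eval_monomial, HahnSeries.coeff_mul_single]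
  simp

open Polynomial in
theorem hahn_isAlgClosed (k : Type*) [Field k] [IsAlgClosed k] : IsAlgClosed (HahnSeries ℝ k) := by
  refine IsAlgClosed.of_exists_root _ fun P _ hirr => ?_
  by_contra hno
  have hno' : ∀ a, P.eval a ≠ 0 := fun a h => hno ⟨a, h⟩
  have hdeg : P.natDegree ≠ 0 := hirr.natDegree_pos.ne'
  choose δ h1 h2 using fun a => hahn_step P hdeg a (hno' a)
  let r : HahnSeries ℝ k → HahnSeries ℝ k → Prop := fun a b =>
    a = b ∨ ((δ a : WithTop ℝ) ≤ (b - a).orderTop ∧ (P.eval a).orderTop < (P.eval b).orderTop)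
  have hsub : ∀ {a b : HahnSeries ℝ k} {g : ℝ}, (g : WithTop ℝ) ≤ (b - a).orderTop →
      ∀ h < g, a.coeff h = b.coeff h := by
    intro a b g hg h hh
    have := HahnSeries.coeff_eq_zero_of_lt_orderTop
      (lt_of_lt_of_le (WithTop.coe_lt_coe.2 hh) hg)
    rw [HahnSeries.coeff_sub] at this
    exact (sub_eq_zero.1 this).symm
  have hsub' : ∀ {a b : HahnSeries ℝ k} {g : ℝ}, (∀ h < g, a.coeff h = b.coeff h) →
      (g : WithTop ℝ) ≤ (b - a).orderTop := by
    intro a b g hg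
    rw [HahnSeries.le_orderTop_iff_forall]
    intro h hh
    rw [HahnSeries.coeff_sub, hg h (WithTop.coe_lt_coe.1 hh), sub_self]
  have hball : ∀ {a b : HahnSeries ℝ k}, (δ a : WithTop ℝ) ≤ (b - a).orderTop →
      (P.eval a).orderTop ≤ (P.eval b).orderTop := by
    intro a b h
    have := h1 a (b - a) h
    simpa using this
  have htrans : ∀ {a b c}, r a b → r b c → r a c := by
    rintro a b c (rfl | ⟨hab, hab'⟩) (rfl | ⟨hbc, hbc'⟩)
    · exact Or.inl rfl
    · exact Or.inr ⟨hbc, hbc'⟩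
    · exact Or.inr ⟨hab, hab'⟩
    · refine Or.inr ⟨?_, hab'.trans hbc'⟩
      have hle : δ a ≤ δ b := by
        by_contra hlt
        push Not at hlt
        have : (δ b : WithTop ℝ) ≤ (a - b).orderTop := by
          apply hsub'
          intro h hh
          exact (hsub hab h (hh.trans hlt)).symm
        exact absurd (hball this) (not_le.2 hab')
      apply hsub'
      intro h hh
      rw [hsub hab h hh, hsub hbc h (hh.trans_le hle)]
  obtain ⟨m, hm⟩ := exists_maximal_of_chains_bounded (r := r) (by
    intro c hc
    by_cases hmax : ∃ ub ∈ c, ∀ a ∈ c, r a ub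
    · obtain ⟨ub, -, h⟩ := hmax; exact ⟨ub, h⟩
    push Not at hmax
    obtain ⟨x, hx⟩ := hahn_spherical c δ (by
      intro a ha b hb g hga hgb
      by_cases hab : a = b
      · rw [hab]
      rcases hc ha hb hab with h | h
      · rcases h with h | h
        · rw [h]
        · exact hsub h.1 g hga
      · rcases h with h | h
        · rw [h]
        · exact (hsub h.1 g hgb).symm)
    refine ⟨x, fun a ha => Or.inr ⟨hsub' fun h hh => (hx a ha h hh).symm, ?_⟩⟩
    obtain ⟨b, hb, hnb⟩ := hmax a ha
    have hne : b ≠ a := fun h => hnb (Or.inl h)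
    have hlt : (P.eval a).orderTop < (P.eval b).orderTop := by
      rcases hc ha hb hne.symm with h | h
      · rcases h with h | h
        · exact absurd h.symm hne
        · exact h.2
      · exact absurd h hnb
    exact hlt.trans_le (hball (hsub' fun h hh => (hx b hb h hh).symm))) htrans
  obtain ⟨y, hy, hlt⟩ := h2 m
  have := hm (m + y) (Or.inr ⟨by simpa using hy, hlt⟩)
  rcases this with h | h
  · rw [h] at hlt; exact lt_irrefl _ hlt
  · exact lt_asymm hlt h.2

end Stmt17


namespace Stmt17
theorem exists_lin_indep_real (ι : Type*) [Finite ι] : ∃ g : ι → ℝ, LinearIndependent ℚ g := by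
  have : Module.rank ℚ ℝ = Cardinal.continuum := Real.rank_rat_real
  let b := Module.Basis.ofVectorSpace ℚ ℝ
  have hinf : Infinite (Module.Basis.ofVectorSpaceIndex ℚ ℝ) := by
    rw [Cardinal.infinite_iff, Module.Basis.mk_eq_rank'' b, this]
    exact Cardinal.aleph0_le_continuum
  obtain ⟨n, ⟨f⟩⟩ := Finite.exists_equiv_fin ι
  let e : ι → Module.Basis.ofVectorSpaceIndex ℚ ℝ := fun i => Infinite.natEmbedding _ (f i)
  have he : Function.Injective e := by
    intro i j h
    have := (Infinite.natEmbedding _).injective h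
    exact f.injective (Fin.ext this)
  exact ⟨_, b.linearIndependent.comp e he⟩

/-- Mathlib's coefficientwise algebra structure, preferred over `HahnSeries.powerSeriesAlgebra`. -/
noncomputable instance hahnAlg (k : Type*) [Field k] : Algebra k (HahnSeries ℝ k) :=
  HahnSeries.instAlgebra

theorem coeff_algebraMap_mul {k : Type*} [Field k] (a : k) (y : HahnSeries ℝ k) (g : ℝ) :
    (algebraMap k (HahnSeries ℝ k) a * y).coeff g = a * y.coeff g := by
  have h : algebraMap k (HahnSeries ℝ k) a = HahnSeries.C a := rfl
  rw [h, HahnSeries.C_mul_eq_smul]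
  rfl

theorem alg_indep_single {k ι : Type*} [Field k] [Finite ι] (g : ι → ℝ)
    (hg : LinearIndependent ℚ g) :
    AlgebraicIndependent k (fun i => (HahnSeries.single (g i) (1 : k) : HahnSeries ℝ k)) := by
  classical
  cases nonempty_fintype ι
  rw [algebraicIndependent_iff]
  intro p hp
  have hinj : ∀ m n : ι →₀ ℕ, ∑ i, m i • g i = ∑ i, n i • g i → m = n := by
    intro m n h
    have h2 : ∑ i, ((m i : ℚ) - (n i : ℚ)) • g i = 0 := by
      simp only [sub_smul, Finset.sum_sub_distrib]
      rw [sub_eq_zero]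
      simpa [Rat.smul_def] using h
    have := Fintype.linearIndependent_iff.1 hg _ h2
    ext i
    have := this i
    rw [sub_eq_zero] at this
    exact_mod_cast this
  have hprod : ∀ m : ι →₀ ℕ, ∏ i, (HahnSeries.single (g i) (1 : k) : HahnSeries ℝ k) ^ m i
      = HahnSeries.single (∑ i, m i • g i) (1 : k) := by
    intro m
    induction (Finset.univ : Finset ι) using Finset.induction_on with
    | empty => simp
    | insert a s ha ih => rw [Finset.prod_insert ha, Finset.sum_insert ha, ih, HahnSeries.single_pow,
        HahnSeries.single_mul_single]; simp
  ext m
  rw [MvPolynomial.aeval_def, MvPolynomial.eval₂_eq'] at hp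
  have hc := congrArg (fun y => HahnSeries.coeff y (∑ i, m i • g i)) hp
  simp only [HahnSeries.coeff_sum, hprod, coeff_algebraMap_mul,
    HahnSeries.coeff_zero] at hc
  rw [Finset.sum_eq_single m] at hc
  · simpa using hc
  · intro n _ hn
    rw [HahnSeries.coeff_single_of_ne (fun h => hn (hinj _ _ h).symm), mul_zero]
  · intro hm
    rw [MvPolynomial.notMem_support_iff.1 hm, zero_mul]

theorem alg_indep_linear {k β κ R : Type*} [Field k] [Fintype β] [Fintype κ] [CommRing R]
    [Algebra k R] (T : κ → R) (hT : AlgebraicIndependent k T) (M : β → κ → k)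
    (hM : LinearIndependent k M) :
    AlgebraicIndependent k (fun b => ∑ j, algebraMap k R (M b j) * T j) := by
  classical
  obtain ⟨Q, hQ⟩ : ∃ Q : κ → β → k, ∀ b b', ∑ j, M b j * Q j b' = if b = b' then 1 else 0 := by
    let f := Fintype.linearCombination k M
    have hf : LinearMap.ker f = ⊥ := by
      rw [LinearMap.ker_eq_bot]; exact hM.fintypeLinearCombination_injective
    obtain ⟨l, hl⟩ := f.exists_leftInverse_of_injective hf
    refine ⟨fun j => l (Pi.single j 1), fun b b' => ?_⟩
    have h1 := congrFun (LinearMap.congr_fun hl (Pi.single b 1)) b'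
    simp only [LinearMap.comp_apply, f, Fintype.linearCombination_apply_single, one_smul,
      LinearMap.id_apply] at h1
    have h2 : M b = ∑ j, M b j • (Pi.single j 1 : κ → k) := by
      ext j; simp [Finset.sum_apply, Pi.single_apply]
    rw [h2, map_sum] at h1
    simp only [map_smul, Finset.sum_apply, Pi.smul_apply, smul_eq_mul] at h1
    rw [h1, Pi.single_apply]; simp [eq_comm]
  let A : MvPolynomial β k →ₐ[k] MvPolynomial κ k :=
    MvPolynomial.aeval (fun b => ∑ j, MvPolynomial.C (M b j) * MvPolynomial.X j)
  let A' : MvPolynomial κ k →ₐ[k] MvPolynomial β k :=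
    MvPolynomial.aeval (fun j => ∑ b, MvPolynomial.C (Q j b) * MvPolynomial.X b)
  have hA : A'.comp A = AlgHom.id k _ := by
    ext1 b
    simp only [AlgHom.comp_apply, A, A', MvPolynomial.aeval_X, map_sum, map_mul, AlgHom.id_apply,
      MvPolynomial.algHom_C, MvPolynomial.algebraMap_eq, Finset.mul_sum]
    rw [Finset.sum_comm]
    simp only [← mul_assoc, ← MvPolynomial.C_mul, ← Finset.sum_mul, ← map_sum, hQ]
    simp
  have hAi : Function.Injective A := by
    have : Function.LeftInverse A' A := fun p => AlgHom.congr_fun hA p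
    exact this.injective
  have : (MvPolynomial.aeval (fun b => ∑ j, algebraMap k R (M b j) * T j) :
      MvPolynomial β k →ₐ[k] R) = (MvPolynomial.aeval T).comp A := by
    ext1 b
    simp [A]
  show Function.Injective _
  rw [this]
  have hT' : Function.Injective (MvPolynomial.aeval T : MvPolynomial κ k →ₐ[k] R) := hT
  rw [AlgHom.coe_comp]
  exact hT'.comp hAi

end Stmt17


namespace Stmt17

theorem exists_lift_algClosure {K Ks Ka : Type*} [Field K] [Field Ks] [Field Ka] [Algebra K Ks]
    [IsSepClosure K Ks] [Algebra Ks Ka] [Algebra K Ka] [IsScalarTower K Ks Ka] [IsAlgClosed Ka]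
    [Algebra.IsAlgebraic Ks Ka] :
    ∃ l : (Ks ≃ₐ[K] Ks) →* (Ka ≃ₐ[K] Ka), ∀ σ x,
      l σ (algebraMap Ks Ka x) = algebraMap Ks Ka (σ x) := by
  have : IsSepClosed Ks := IsSepClosure.sep_closed K
  have : Algebra.IsSeparable K Ks := IsSepClosure.separable
  have : IsGalois K Ks := inferInstance
  have : Algebra.IsAlgebraic K Ka := Algebra.IsAlgebraic.trans K Ks Ka
  have hc : IsAlgClosure K Ka := ⟨inferInstance, inferInstance⟩
  have : Normal K Ka := IsAlgClosure.normal K Ka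
  have hpi : IsPurelyInseparable Ks Ka := inferInstance
  let r : (Ka ≃ₐ[K] Ka) →* (Ks ≃ₐ[K] Ks) := AlgEquiv.restrictNormalHom Ks
  have hr : ∀ τ x, algebraMap Ks Ka (r τ x) = τ (algebraMap Ks Ka x) := by
    intro τ x
    exact AlgEquiv.restrictNormal_commutes τ Ks x
  have hsurj : Function.Surjective r := AlgEquiv.restrictNormalHom_surjective Ka
  have hinj : Function.Injective r := by
    intro τ τ' h
    have : (τ : Ka →+* Ka) = τ' := by
      apply IsPurelyInseparable.injective_comp_algebraMap Ks Ka Ka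
      ext x
      have := congrArg (fun t => algebraMap Ks Ka (t x)) h
      simp only [hr] at this
      simpa using this
    ext x
    exact RingHom.congr_fun this x
  let e := MulEquiv.ofBijective r ⟨hinj, hsurj⟩
  refine ⟨e.symm.toMonoidHom, fun σ x => ?_⟩
  have h1 := hr (e.symm σ) x
  have h2 : r (e.symm σ) = σ := e.apply_symm_apply σ
  rw [h2] at h1
  exact h1.symm

/-- Coefficientwise action of field automorphisms on Hahn series. -/
noncomputable def hahnMap {k : Type*} [Field k] (f : k ≃+* k) : HahnSeries ℝ k ≃+* HahnSeries ℝ k where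
  toFun x := x.map (f : k →+* k)
  invFun x := x.map (f.symm : k →+* k)
  left_inv x := by ext; simp
  right_inv x := by ext; simp
  map_mul' x y := HahnSeries.map_mul ((f : k →+* k) : k →ₙ+* k)
  map_add' x y := by ext; simp

theorem hahnMap_coeff {k : Type*} [Field k] (f : k ≃+* k) (x : HahnSeries ℝ k) (g : ℝ) :
    (hahnMap f x).coeff g = f (x.coeff g) := rfl

theorem hahnMap_single {k : Type*} [Field k] (f : k ≃+* k) (g : ℝ) (a : k) :
    hahnMap f (HahnSeries.single g a) = HahnSeries.single g (f a) := by
  ext h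
  rw [hahnMap_coeff]
  by_cases hh : h = g
  · subst hh; simp
  · simp [HahnSeries.coeff_single_of_ne hh]

theorem isClosed_fix_lift {K Ks Ka : Type*} [Field K] [Field Ks] [Field Ka] [Algebra K Ks]
    [IsSepClosure K Ks] [Algebra Ks Ka] [Algebra K Ka] [IsScalarTower K Ks Ka]
    [Algebra.IsAlgebraic Ks Ka]
    (l : (Ks ≃ₐ[K] Ks) →* (Ka ≃ₐ[K] Ka))
    (hl : ∀ σ x, l σ (algebraMap Ks Ka x) = algebraMap Ks Ka (σ x)) (a : Ka) :
    IsClosed {σ : Ks ≃ₐ[K] Ks | l σ a = a} := by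
  have : IsSepClosed Ks := IsSepClosure.sep_closed K
  have : Algebra.IsSeparable K Ks := IsSepClosure.separable
  have hpi : IsPurelyInseparable Ks Ka := inferInstance
  obtain ⟨n, y, hy⟩ := IsPurelyInseparable.pow_mem Ks (ringExpChar Ks) a
  have : ExpChar Ka (ringExpChar Ks) := expChar_of_injective_algebraMap (algebraMap Ks Ka).injective _
  have hset : {σ : Ks ≃ₐ[K] Ks | l σ a = a} = (MulAction.stabilizer (Ks ≃ₐ[K] Ks) y : Set _) := by
    ext σ
    simp only [Set.mem_ofPred_eq, SetLike.mem_coe, MulAction.mem_stabilizer_iff, AlgEquiv.smul_def]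
    constructor
    · intro h
      apply (algebraMap Ks Ka).injective
      rw [← hl, hy, map_pow, h]
    · intro h
      have h2 : (l σ a) ^ (ringExpChar Ks) ^ n = a ^ (ringExpChar Ks) ^ n := by
        rw [← map_pow, ← hy, hl, h]
      exact iterateFrobenius_inj Ka (ringExpChar Ks) n h2
  rw [hset]
  exact Subgroup.isClosed_of_isOpen _ (stabilizer_isOpen_of_isIntegral y)

theorem core {K Ks Ka E0 Ls B : Type*} [Field K] [Field Ks] [Field Ka] [Algebra K Ks]
    [IsSepClosure K Ks] [Algebra Ks Ka] [Algebra K Ka] [IsScalarTower K Ks Ka]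
    [Algebra.IsAlgebraic Ks Ka] [Group B]
    [Field E0] [Field Ls] [Algebra E0 Ls] [IsSepClosure E0 Ls] [Algebra Ks Ls]
    (l : (Ks ≃ₐ[K] Ks) →* (Ka ≃ₐ[K] Ka))
    (hl : ∀ σ x, l σ (algebraMap Ks Ka x) = algebraMap Ks Ka (σ x))
    (G : Subgroup (Ks ≃ₐ[K] Ks)) (x : B → Ls) (c : G → B)
    (j : Ls →+* HahnSeries ℝ Ka)
    (hjKs : ∀ a, j (algebraMap Ks Ls a) = HahnSeries.single 0 (algebraMap Ks Ka a))
    (hjx : ∀ (σ : G) b, hahnMap (l σ : Ka ≃+* Ka) (j (x b)) = j (x (c σ * b)))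
    (hjE : ∀ (σ : G) e, hahnMap (l σ : Ka ≃+* Ka) (j (algebraMap E0 Ls e)) = j (algebraMap E0 Ls e)) :
    ∃ s : G →* (Ls ≃ₐ[E0] Ls), Continuous s ∧
      (∀ σ a, s σ (algebraMap Ks Ls a) = algebraMap Ks Ls ((σ : Ks ≃ₐ[K] Ks) a)) ∧
      (∀ σ b, s σ (x b) = x (c σ * b)) := by
  have : IsSepClosed Ls := IsSepClosure.sep_closed E0
  have : Algebra.IsSeparable E0 Ls := IsSepClosure.separable
  have : IsGalois E0 Ls := inferInstance
  let a1 : Algebra Ls (HahnSeries ℝ Ka) := j.toAlgebra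
  let a2 : Algebra E0 (HahnSeries ℝ Ka) := (j.comp (algebraMap E0 Ls)).toAlgebra
  have a3 : IsScalarTower E0 Ls (HahnSeries ℝ Ka) := IsScalarTower.of_algebraMap_eq fun _ => rfl
  let Θ : G →* (HahnSeries ℝ Ka ≃ₐ[E0] HahnSeries ℝ Ka) :=
    { toFun := fun σ => AlgEquiv.ofRingEquiv (f := hahnMap (l σ : Ka ≃+* Ka)) (hjE σ)
      map_one' := by
        ext y g
        show (hahnMap _ y).coeff g = _
        rw [hahnMap_coeff]; simp
      map_mul' := by
        intro σ τ
        ext y g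
        show (hahnMap _ y).coeff g = (hahnMap _ (hahnMap _ y)).coeff g
        simp [hahnMap_coeff] }
  let s : G →* (Ls ≃ₐ[E0] Ls) := (AlgEquiv.restrictNormalHom Ls).comp Θ
  have hs : ∀ σ y, j (s σ y) = hahnMap (l σ : Ka ≃+* Ka) (j y) := fun σ y =>
    AlgEquiv.restrictNormal_commutes (Θ σ) Ls y
  refine ⟨s, ?_, fun σ a => j.injective ?_, fun σ b => j.injective ?_⟩
  · have hclosed : ∀ y : Ls, IsClosed {σ : G | s σ y = y} := by
      intro y
      have : {σ : G | s σ y = y} = ⋂ g : ℝ, Subtype.val ⁻¹'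
          {σ : Ks ≃ₐ[K] Ks | l σ ((j y).coeff g) = (j y).coeff g} := by
        ext σ
        simp only [Set.mem_ofPred_eq, Set.mem_iInter, Set.mem_preimage]
        rw [← j.injective.eq_iff, hs, HahnSeries.ext_iff, funext_iff]
        rfl
      rw [this]
      exact isClosed_iInter fun g => (isClosed_fix_lift l hl _).preimage continuous_subtype_val
    apply continuous_of_continuousAt_one
    rw [ContinuousAt, map_one]
    intro U hU
    obtain ⟨E, hE, hEU⟩ := (krullTopology_mem_nhds_one_iff E0 Ls U).1 hU
    have hopen : IsOpen (E.fixingSubgroup : Set (Ls ≃ₐ[E0] Ls)) :=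
      IntermediateField.fixingSubgroup_isOpen E
    have hfq : Finite ((Ls ≃ₐ[E0] Ls) ⧸ E.fixingSubgroup) :=
      Subgroup.quotient_finite_of_isOpen _ hopen
    have hfi : E.fixingSubgroup.FiniteIndex := Subgroup.finiteIndex_of_finite_quotient
    have hfi2 : (E.fixingSubgroup.comap s).FiniteIndex := ⟨by
      rw [Subgroup.index_comap]
      exact fun h => Subgroup.FiniteIndex.index_ne_zero (Subgroup.index_eq_zero_of_relIndex_eq_zero h)⟩
    have hcl : IsClosed ((E.fixingSubgroup.comap s : Subgroup G) : Set G) := by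
      have : ((E.fixingSubgroup.comap s : Subgroup G) : Set G) = ⋂ y : E, {σ : G | s σ y = y} := by
        ext σ
        simp [IntermediateField.mem_fixingSubgroup_iff]
      rw [this]
      exact isClosed_iInter fun y => hclosed _
    have hop : IsOpen ((E.fixingSubgroup.comap s : Subgroup G) : Set G) :=
      Subgroup.isOpen_of_isClosed_of_finiteIndex _ hcl
    exact Filter.mem_map.2 (Filter.mem_of_superset (hop.mem_nhds (one_mem _)) fun σ hσ => hEU hσ)
  · rw [hs, hjKs, hjKs, hahnMap_single, AlgEquiv.coe_ringEquiv, hl]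
  · rw [hs, hjx]

end Stmt17

namespace Stmt17

theorem exists_u {K Ks Ka A B : Type*} [Field K] [Field Ks] [Field Ka] [Algebra K Ks]
    [IsSepClosure K Ks] [Algebra Ks Ka] [Algebra K Ka] [IsScalarTower K Ks Ka]
    [Group A] [TopologicalSpace A] [DiscreteTopology A] [Group B] [Finite B]
    (φ : (Ks ≃ₐ[K] Ks) →* A) (hφcont : Continuous φ)
    (ψ : B →* A) (G : Subgroup (Ks ≃ₐ[K] Ks)) (Bi : Subgroup B)
    (hB : Set.BijOn ψ (Bi : Set B) (φ '' (G : Set (Ks ≃ₐ[K] Ks))))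
    (l : (Ks ≃ₐ[K] Ks) →* (Ka ≃ₐ[K] Ka))
    (hl : ∀ σ x, l σ (algebraMap Ks Ka x) = algebraMap Ks Ka (σ x)) :
    ∃ (u : B → HahnSeries ℝ Ka) (c : G → B), AlgebraicIndependent Ka u ∧
      (∀ σ, c σ ∈ Bi) ∧ (∀ σ, ψ (c σ) = φ σ) ∧
      ∀ (σ : G) b, hahnMap (l σ : Ka ≃+* Ka) (u b) = u (c σ * b) := by
  classical
  cases nonempty_fintype B
  have hsepK : Algebra.IsSeparable K Ks := IsSepClosure.separable
  have hscK : IsSepClosed Ks := IsSepClosure.sep_closed K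
  have : IsGalois K Ks := inferInstance
  have hop : IsOpen (φ.ker : Set (Ks ≃ₐ[K] Ks)) :=
    (isOpen_discrete ({1} : Set A)).preimage hφcont
  let N : IntermediateField K Ks := IntermediateField.fixedField φ.ker
  have hN : N.fixingSubgroup = φ.ker :=
    InfiniteGalois.fixingSubgroup_fixedField ⟨φ.ker, Subgroup.isClosed_of_isOpen _ hop⟩
  have hfd : FiniteDimensional K N := by
    rw [← InfiniteGalois.isOpen_iff_finite, hN]; exact hop
  let e := Module.finBasis K N
  have hex : ∀ d : B, ∃ σ : Ks ≃ₐ[K] Ks, d ∈ Bi → σ ∈ G ∧ φ σ = ψ d := by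
    intro d
    by_cases hd : d ∈ Bi
    · obtain ⟨σ, h1, h2⟩ := hB.mapsTo hd
      exact ⟨σ, fun _ => ⟨h1, h2⟩⟩
    · exact ⟨1, fun h => absurd h hd⟩
  choose sg hsg using hex
  have hcx : ∀ σ : G, ∃ d ∈ Bi, ψ d = φ σ := fun σ => hB.surjOn ⟨σ, σ.2, rfl⟩
  choose c hcB hc using hcx
  have hNeq : ∀ σ τ : Ks ≃ₐ[K] Ks, φ σ = φ τ ↔ ∀ y : N, σ y = τ y := by
    intro σ τ
    have h1 : φ σ = φ τ ↔ τ⁻¹ * σ ∈ φ.ker := by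
      rw [MonoidHom.mem_ker, map_mul, map_inv, inv_mul_eq_one, eq_comm]
    rw [h1, ← hN, IntermediateField.mem_fixingSubgroup_iff]
    constructor
    · intro h y
      have := h y y.2
      rw [AlgEquiv.mul_apply] at this
      have h2 := congrArg τ this
      rwa [← AlgEquiv.mul_apply, mul_inv_cancel] at h2
    · intro h y hy
      rw [AlgEquiv.mul_apply, h ⟨y, hy⟩]
      exact τ.symm_apply_apply y
  let κ := Fin (Module.finrank K N)
  let M : B → B × κ → Ka := fun b p =>
    if b * p.1⁻¹ ∈ Bi then algebraMap Ks Ka (sg (b * p.1⁻¹) (e p.2)) else 0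
  obtain ⟨g, hg⟩ := exists_lin_indep_real (B × κ)
  let T : B × κ → HahnSeries ℝ Ka := fun p => HahnSeries.single (g p) 1
  have hM : LinearIndependent Ka M := by
    rw [Fintype.linearIndependent_iff]
    intro a ha b0
    let f : Bi → (N →* Ka) := fun d =>
      ((algebraMap Ks Ka : Ks →* Ka).comp ((sg d : Ks ≃ₐ[K] Ks) : Ks →* Ks)).comp
        (algebraMap N Ks : N →* Ks)
    have hf : ∀ d y, f d y = algebraMap Ks Ka (sg d (y : Ks)) := fun d y => rfl
    have hfinj : Function.Injective f := by
      intro d d' h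
      apply Subtype.ext
      apply hB.injOn d.2 d'.2
      rw [← (hsg d d.2).2, ← (hsg d' d'.2).2, hNeq]
      intro y
      exact (algebraMap Ks Ka).injective (DFunLike.congr_fun h y)
    have hli : LinearIndependent Ka (fun d => (f d : N → Ka)) :=
      (linearIndependent_monoidHom N Ka).comp f hfinj
    rw [Fintype.linearIndependent_iff] at hli
    have key : ∑ d : Bi, a (d * b0) • (f d : N → Ka) = 0 := by
      let F : N →ₗ[K] Ka := ∑ d : Bi, LinearMap.mulLeft K (a (d * b0)) ∘ₗ
        (IsScalarTower.toAlgHom K Ks Ka).toLinearMap ∘ₗ (sg d).toLinearMap ∘ₗ N.val.toLinearMap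
      have hF : F = 0 := by
        refine e.ext fun k => ?_
        have h1 := congrFun ha (b0, k)
        simp only [Finset.sum_apply, Pi.smul_apply, smul_eq_mul, Pi.zero_apply, M] at h1
        have h2 : F (e k) = ∑ d : Bi, a (d * b0) * algebraMap Ks Ka (sg d (e k)) := by
          simp [F]
        rw [h2, LinearMap.zero_apply, ← h1]
        rw [← Equiv.sum_comp (Equiv.mulRight b0)]
        simp only [Equiv.coe_mulRight, mul_inv_cancel_right, mul_ite, mul_zero]
        rw [← Finset.sum_filter]
        exact (Finset.sum_subtype _ (by simp) (fun d => a (d * b0) * algebraMap Ks Ka (sg d (e k)))).symm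
      funext y
      have := LinearMap.congr_fun hF y
      simp only [F, LinearMap.sum_apply] at this
      simpa [hf] using this
    have := hli _ key 1
    simpa using this
  refine ⟨fun b => ∑ p, algebraMap Ka (HahnSeries ℝ Ka) (M b p) * T p, c,
    alg_indep_linear T (alg_indep_single g hg) M hM, hcB, hc, ?_⟩
  intro σ b
  rw [map_sum]
  refine Finset.sum_congr rfl fun p _ => ?_
  have h1 : ∀ a : Ka, algebraMap Ka (HahnSeries ℝ Ka) a = HahnSeries.single 0 a := fun a => rfl
  rw [map_mul, h1, hahnMap_single, hahnMap_single, h1]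
  have h2 : (l σ : Ka ≃+* Ka) (M b p) = M (c σ * b) p := by
    simp only [M, mul_assoc, Subgroup.mul_mem_cancel_left _ (hcB σ)]
    split_ifs with hm
    · rw [AlgEquiv.coe_ringEquiv, hl]
      congr 1
      have := (hNeq (σ * sg (b * p.1⁻¹)) (sg (c σ * (b * p.1⁻¹)))).1 (by
        rw [map_mul, (hsg _ hm).2, (hsg _ (mul_mem (hcB σ) hm)).2, map_mul ψ (c σ), hc]) (e p.2)
      exact this
    · simp
  rw [h2, AlgEquiv.coe_ringEquiv, map_one]

end Stmt17

namespace Stmt17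

section field

variable {K Ks FF Ls B : Type} [Field K] [Field Ks] [Algebra K Ks] [IsSepClosure K Ks] [Fintype B]
  [Field FF] [Algebra (MvPolynomial B Ks) FF] [IsFractionRing (MvPolynomial B Ks) FF]
  [Algebra Ks FF] [IsScalarTower Ks (MvPolynomial B Ks) FF]
  [Field Ls] [Algebra FF Ls] [IsSepClosure FF Ls] [Algebra Ks Ls] [IsScalarTower Ks FF Ls]
  [Algebra K Ls] [IsScalarTower K Ks Ls]

/-- The generic elements. -/
noncomputable def xx (Ks FF Ls : Type) {B : Type} [Field Ks] [Field FF]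
    [Algebra (MvPolynomial B Ks) FF] [Field Ls] [Algebra FF Ls] (b : B) : Ls :=
  algebraMap FF Ls (algebraMap (MvPolynomial B Ks) FF (MvPolynomial.X b))

/-- The field generated by the elementary symmetric functions of the `x b`. -/
noncomputable def EE (K : Type) {B Ls : Type} [Field K] [Fintype B] [Field Ls] [Algebra K Ls]
    (x : B → Ls) : IntermediateField K Ls :=
  IntermediateField.adjoin K
    (Set.range (∏ b, (Polynomial.X - Polynomial.C (x b))).coeff)

theorem xx_injective : Function.Injective (xx Ks FF Ls : B → Ls) := by
  intro b b' h
  have h1 := (algebraMap FF Ls).injective h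
  have h2 := IsFractionRing.injective (MvPolynomial B Ks) FF h1
  exact MvPolynomial.X_injective h2

theorem isSepClosure_EE : IsSepClosure (EE K (xx Ks FF Ls : B → Ls)) Ls := by
  classical
  set x : B → Ls := xx Ks FF Ls with hxdef
  set E := EE K x with hE
  have hsc : IsSepClosed Ls := IsSepClosure.sep_closed FF
  have hsepF : Algebra.IsSeparable FF Ls := IsSepClosure.separable
  have hsepK : Algebra.IsSeparable K Ks := IsSepClosure.separable
  refine ⟨hsc, ?_⟩
  let S := separableClosure E Ls
  have hxS : ∀ b, x b ∈ S := by
    intro b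
    rw [mem_separableClosure_iff]
    let P : Polynomial Ls := ∏ b, (Polynomial.X - Polynomial.C (x b))
    have hP : P ∈ Polynomial.lifts (algebraMap E Ls) := by
      rw [Polynomial.lifts_iff_coeff_lifts]
      intro m
      exact ⟨⟨P.coeff m, IntermediateField.subset_adjoin _ _ ⟨m, rfl⟩⟩, rfl⟩
    obtain ⟨Q, hQ⟩ := (Polynomial.mem_lifts _).1 hP
    have hsepP : P.Separable := Polynomial.separable_prod_X_sub_C_iff.2 xx_injective
    have hsepQ : Q.Separable := by
      rw [← hQ] at hsepP
      exact (Polynomial.separable_map _).1 hsepP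
    refine hsepQ.of_dvd (minpoly.dvd _ _ ?_)
    rw [Polynomial.aeval_def, ← Polynomial.eval_map, hQ, Polynomial.eval_prod]
    exact Finset.prod_eq_zero (Finset.mem_univ b) (by simp)
  have hKs : ∀ a : Ks, algebraMap Ks Ls a ∈ S := by
    intro a
    rw [mem_separableClosure_iff]
    have h1 : IsSeparable K a := Algebra.IsSeparable.isSeparable K a
    have h2 : IsSeparable K (algebraMap Ks Ls a) :=
      h1.map (IsScalarTower.toAlgHom K Ks Ls) (algebraMap Ks Ls).injective
    exact h2.tower_top E
  have hPoly : ∀ p : MvPolynomial B Ks, algebraMap FF Ls (algebraMap _ FF p) ∈ S := by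
    intro p
    induction p using MvPolynomial.induction_on with
    | C a =>
      have : algebraMap FF Ls (algebraMap (MvPolynomial B Ks) FF (MvPolynomial.C a)) =
          algebraMap Ks Ls a := by
        rw [IsScalarTower.algebraMap_apply Ks FF Ls,
          IsScalarTower.algebraMap_apply Ks (MvPolynomial B Ks) FF]; rfl
      rw [this]; exact hKs a
    | add p q hp hq => rw [map_add, map_add]; exact add_mem hp hq
    | mul_X p b hp => rw [map_mul, map_mul]; exact mul_mem hp (hxS b)
  have hF : ∀ f : FF, algebraMap FF Ls f ∈ S := by
    intro f
    obtain ⟨p, q, hq, rfl⟩ := IsFractionRing.div_surjective (A := MvPolynomial B Ks) f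
    rw [map_div₀]
    exact div_mem (hPoly p) (hPoly q)
  let iF : FF →+* S := (algebraMap FF Ls).codRestrict S hF
  let aF : Algebra FF S := iF.toAlgebra
  have tF : IsScalarTower FF S Ls := IsScalarTower.of_algebraMap_eq fun _ => rfl
  refine ⟨fun y => ?_⟩
  have h1 : IsSeparable FF y := Algebra.IsSeparable.isSeparable FF y
  exact IsSeparable.of_algebra_isSeparable_of_isSeparable E (h1.tower_top S)

theorem trdeg_Ls (K Ks FF Ls B : Type) [Field K] [Field Ks] [Algebra K Ks] [IsSepClosure K Ks]
    [Fintype B] [Field FF] [Algebra (MvPolynomial B Ks) FF]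
    [IsFractionRing (MvPolynomial B Ks) FF]
    [Algebra Ks FF] [IsScalarTower Ks (MvPolynomial B Ks) FF]
    [Field Ls] [Algebra FF Ls] [IsSepClosure FF Ls] [Algebra Ks Ls] [IsScalarTower Ks FF Ls]
    [Algebra K Ls] [IsScalarTower K Ks Ls] :
    Algebra.trdeg K Ls = (Fintype.card B : ℕ) := by
  have hsepK : Algebra.IsSeparable K Ks := IsSepClosure.separable
  have hsepF : Algebra.IsSeparable FF Ls := IsSepClosure.separable
  have h1 := trdeg_add_eq K Ks (A := Ls)
  have h2 := trdeg_add_eq Ks FF (A := Ls)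
  have h3 := trdeg_add_eq Ks (MvPolynomial B Ks) (A := FF)
  have h4 : Algebra.trdeg (MvPolynomial B Ks) FF = 0 := by
    have : Algebra.IsAlgebraic (MvPolynomial B Ks) FF := IsLocalization.isAlgebraic FF (nonZeroDivisors (MvPolynomial B Ks))
    exact trdeg_eq_zero
  have h5 : Algebra.trdeg FF Ls = 0 := trdeg_eq_zero
  have h6 : Algebra.trdeg K Ks = 0 := trdeg_eq_zero
  have h7 := MvPolynomial.trdeg_of_isDomain (ι := B) (S := Ks)
  rw [← h1, h6, ← h2, h5, ← h3, h4, h7]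
  simp

theorem exists_j {Ka : Type} [Field Ka] [IsAlgClosed Ka] [Algebra Ks Ka]
    (u : B → HahnSeries ℝ Ka) (hu : AlgebraicIndependent Ka u) :
    ∃ j : Ls →+* HahnSeries ℝ Ka,
      (∀ a, j (algebraMap Ks Ls a) = HahnSeries.single 0 (algebraMap Ks Ka a)) ∧
      ∀ b : B, j (xx Ks FF Ls b) = u b := by
  have hac := hahn_isAlgClosed Ka
  have hsepF : Algebra.IsSeparable FF Ls := IsSepClosure.separable
  let f : MvPolynomial B Ks →+* HahnSeries ℝ Ka :=
    (MvPolynomial.aeval u : MvPolynomial B Ka →ₐ[Ka] HahnSeries ℝ Ka).toRingHom.comp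
      (MvPolynomial.map (algebraMap Ks Ka))
  have hu2 : Function.Injective (MvPolynomial.aeval u : MvPolynomial B Ka →ₐ[Ka] HahnSeries ℝ Ka) :=
    hu
  have hfe : ∀ p, f p = MvPolynomial.aeval u (MvPolynomial.map (algebraMap Ks Ka) p) := fun p => rfl
  have hf : Function.Injective f := by
    intro p q h
    rw [hfe, hfe] at h
    exact MvPolynomial.map_injective _ (algebraMap Ks Ka).injective (hu2 h)
  let f2 : FF →+* HahnSeries ℝ Ka := IsFractionRing.lift hf
  let aF : Algebra FF (HahnSeries ℝ Ka) := f2.toAlgebra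
  let j : Ls →ₐ[FF] HahnSeries ℝ Ka := IsAlgClosed.lift
  have hj : ∀ p : MvPolynomial B Ks, j (algebraMap FF Ls (algebraMap _ FF p)) = f p := by
    intro p
    rw [j.commutes]
    exact IsFractionRing.lift_algebraMap hf p
  refine ⟨j, fun a => ?_, fun b => ?_⟩
  · have : algebraMap Ks Ls a =
        algebraMap FF Ls (algebraMap (MvPolynomial B Ks) FF (MvPolynomial.C a)) := by
      rw [IsScalarTower.algebraMap_apply Ks FF Ls,
        IsScalarTower.algebraMap_apply Ks (MvPolynomial B Ks) FF]; rfl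
    rw [this]
    refine (hj _).trans ?_
    rw [hfe, MvPolynomial.map_C]
    exact MvPolynomial.aeval_C u _
  · refine (hj _).trans ?_
    rw [hfe, MvPolynomial.map_X]
    exact MvPolynomial.aeval_X u _

end field

theorem fix_EE {K Ls H B : Type} [Field K] [Field Ls] [Algebra K Ls] [Fintype B] [Group B] [Field H]
    (x : B → Ls) (j : Ls →+* H) (θ : H →+* H) (c : B)
    (hx : ∀ b, θ (j (x b)) = j (x (c * b)))
    (hK : ∀ a : K, θ (j (algebraMap K Ls a)) = j (algebraMap K Ls a)) (e : EE K x) :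
    θ (j (algebraMap (EE K x) Ls e)) = j (algebraMap (EE K x) Ls e) := by
  obtain ⟨e, he⟩ := e
  show θ (j e) = j e
  unfold EE at he
  induction he using IntermediateField.adjoin_induction with
  | mem y hy =>
    obtain ⟨m, rfl⟩ := hy
    have h1 : (∏ b, (Polynomial.X - Polynomial.C (x b))).map (θ.comp j) =
        (∏ b, (Polynomial.X - Polynomial.C (x b))).map j := by
      simp only [Polynomial.map_prod, Polynomial.map_sub, Polynomial.map_X, Polynomial.map_C,
        RingHom.comp_apply, hx]
      exact Fintype.prod_equiv (Equiv.mulLeft c) _ _ (fun b => rfl)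
    have h2 := congrArg (fun q => q.coeff m) h1
    simpa only [Polynomial.coeff_map, RingHom.comp_apply] using h2
  | algebraMap a => exact hK a
  | add a b _ _ ha hb => rw [map_add, map_add, ha, hb]
  | inv a _ ha => rw [map_inv₀, map_inv₀, ha]
  | mul a b _ _ ha hb => rw [map_mul, map_mul, ha, hb]

end Stmt17


namespace Stmt17

theorem assembly {n : ℕ} {K Ks E0 Ls A B : Type} [Field K]
    [Field Ks] [Algebra K Ks] [IsSepClosure K Ks]
    (Ki : Fin n → IntermediateField K Ks)
    [Group A] [Finite A] [TopologicalSpace A] [DiscreteTopology A]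
    [Group B] [Finite B] [TopologicalSpace B] [DiscreteTopology B]
    (φ : (Ks ≃ₐ[K] Ks) →* A) (hφcont : Continuous φ)
    (ψ : B →* A)
    (Bi : Fin n → Subgroup B) (hBgen : ⨆ i, Bi i = ⊤)
    (hBiso : ∀ i, Set.BijOn ψ (Bi i : Set B) (φ '' ((Ki i).fixingSubgroup : Set (Ks ≃ₐ[K] Ks))))
    [Field E0] [Algebra K E0] [Field Ls] [Algebra E0 Ls] [Algebra K Ls] [IsScalarTower K E0 Ls]
    [Algebra Ks Ls] [IsScalarTower K Ks Ls] [IsSepClosure E0 Ls]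
    (htr : ∃ m : ℕ, 0 < m ∧ Algebra.trdeg K Ls = m)
    (x : B → Ls) (hx : Function.Injective x)
    (c : ∀ i, (Ki i).fixingSubgroup → B) (hcB : ∀ i σ, c i σ ∈ Bi i)
    (hc : ∀ i σ, ψ (c i σ) = φ σ)
    (s : ∀ i, (Ki i).fixingSubgroup →* (Ls ≃ₐ[E0] Ls)) (hs : ∀ i, Continuous (s i))
    (hs1 : ∀ i σ a, s i σ (algebraMap Ks Ls a) = algebraMap Ks Ls ((σ : Ks ≃ₐ[K] Ks) a))
    (hs2 : ∀ i σ b, s i σ (x b) = x (c i σ * b)) :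
    ∃ (L : Type) (_ : Field L) (_ : Algebra K L)
      (Ls : Type) (_ : Field Ls) (_ : Algebra L Ls) (_ : IsSepClosure L Ls)
      (_ : Algebra K Ls) (_ : IsScalarTower K L Ls)
      (_ : Algebra Ks Ls) (_ : IsScalarTower K Ks Ls)
      (Li : Fin n → IntermediateField L Ls)
      (R : (Ls ≃ₐ[L] Ls) →* (Ks ≃ₐ[K] Ks)),
      (∀ (σ : Ls ≃ₐ[L] Ls) (x : Ks), algebraMap Ks Ls (R σ x) = σ (algebraMap Ks Ls x)) ∧
      (∃ s : Finset L, s.Nonempty ∧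
        IsTranscendenceBasis K (Subtype.val : ((s : Set L)) → L)) ∧
      (⨅ i, Li i) = ⊥ ∧
      (∀ i, algebraMap Ks Ls '' (Ki i : Set Ks) ⊆ (Li i : Set Ls)) ∧
      (∀ i, Set.BijOn R ((Li i).fixingSubgroup : Set (Ls ≃ₐ[L] Ls))
        ((Ki i).fixingSubgroup : Set (Ks ≃ₐ[K] Ks))) ∧
      ∃ γ : (Ls ≃ₐ[L] Ls) →* B, Continuous γ ∧ Function.Surjective γ ∧
        (∀ σ, ψ (γ σ) = φ (R σ)) ∧
        ∀ i, Subgroup.map γ ((Li i).fixingSubgroup) = Bi i := by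
  have : IsSepClosed Ls := IsSepClosure.sep_closed E0
  have hsep0 : Algebra.IsSeparable E0 Ls := IsSepClosure.separable
  have hsepK : Algebra.IsSeparable K Ks := IsSepClosure.separable
  have hscK : IsSepClosed Ks := IsSepClosure.sep_closed K
  have : IsGalois E0 Ls := inferInstance
  have : IsGalois K Ks := inferInstance
  -- the fields L_i
  let M : Fin n → IntermediateField E0 Ls := fun i => IntermediateField.fixedField (s i).range
  have hMfix : ∀ i, (M i).fixingSubgroup = (s i).range := by
    intro i
    have hcomp : CompactSpace (Ki i).fixingSubgroup :=
      isCompact_iff_compactSpace.1 ((InfiniteGalois.fixingSubgroup_isClosed (Ki i)).isCompact)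
    have hcl : IsClosed ((s i).range : Set (Ls ≃ₐ[E0] Ls)) := by
      rw [MonoidHom.coe_range]
      exact (isCompact_range (hs i)).isClosed
    exact InfiniteGalois.fixingSubgroup_fixedField ⟨(s i).range, hcl⟩
  let L : IntermediateField E0 Ls := ⨅ i, M i
  have hLM : ∀ i, L ≤ M i := fun i => iInf_le _ i
  have hsepL : Algebra.IsSeparable L Ls := Algebra.isSeparable_tower_top_of_isSeparable E0 L Ls
  have hscL : IsSepClosure L Ls := ⟨inferInstance, inferInstance⟩
  have hgalL : IsGalois L Ls := inferInstance
  let Li : Fin n → IntermediateField L Ls := fun i => IntermediateField.extendScalars (hLM i)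
  have hmemLi : ∀ i y, y ∈ Li i ↔ ∀ σ, s i σ y = y := by
    intro i y
    rw [IntermediateField.mem_extendScalars, IntermediateField.mem_fixedField_iff]
    exact ⟨fun h σ => h _ ⟨σ, rfl⟩, by rintro h _ ⟨σ, rfl⟩; exact h σ⟩
  have hiInf : (⨅ i, Li i) = ⊥ := by
    rw [eq_bot_iff]
    intro y hy
    have : y ∈ L := by
      rw [← SetLike.mem_coe, IntermediateField.coe_iInf, Set.mem_iInter] at hy ⊢
      intro i
      exact (IntermediateField.mem_extendScalars (hLM i)).1 (hy i)
    exact IntermediateField.mem_bot.2 ⟨⟨y, this⟩, rfl⟩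
  -- restriction
  have htow : IsScalarTower K L Ls := IsScalarTower.of_algebraMap_eq fun y => rfl
  let rs : (Ls ≃ₐ[L] Ls) →* (Ls ≃ₐ[K] Ls) :=
    { toFun := fun σ => σ.restrictScalars K
      map_one' := rfl
      map_mul' := fun _ _ => rfl }
  let R : (Ls ≃ₐ[L] Ls) →* (Ks ≃ₐ[K] Ks) :=
    (AlgEquiv.restrictNormalHom Ks).comp rs
  have hR : ∀ (σ : Ls ≃ₐ[L] Ls) (x : Ks), algebraMap Ks Ls (R σ x) = σ (algebraMap Ks Ls x) := by
    intro σ y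
    exact AlgEquiv.restrictNormal_commutes (σ.restrictScalars K) Ks y
  -- lift of s i to Gal(Ls/L)
  have hfix : ∀ i σ (y : L), s i σ y = y := by
    intro i σ y
    exact (IntermediateField.mem_fixedField_iff _ _).1 (hLM i y.2) _ ⟨σ, rfl⟩
  let t : ∀ i, (Ki i).fixingSubgroup → (Ls ≃ₐ[L] Ls) := fun i σ =>
    AlgEquiv.ofRingEquiv (f := (s i σ : Ls ≃+* Ls)) (hfix i σ)
  have ht : ∀ i σ y, t i σ y = s i σ y := fun i σ y => rfl
  have hRt : ∀ i σ, R (t i σ) = σ := by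
    intro i σ
    ext y
    apply (algebraMap Ks Ls).injective
    rw [hR, ht, hs1]
  have htfix : ∀ i σ, t i σ ∈ (Li i).fixingSubgroup := by
    intro i σ
    rw [IntermediateField.mem_fixingSubgroup_iff]
    intro y hy
    exact (hmemLi i y).1 hy σ
  have htsurj : ∀ i τ, τ ∈ (Li i).fixingSubgroup → ∃ σ, t i σ = τ := by
    intro i τ hτ
    have h1 : τ.restrictScalars E0 ∈ (M i).fixingSubgroup := by
      rw [IntermediateField.mem_fixingSubgroup_iff] at hτ ⊢
      intro y hy
      exact hτ y hy
    rw [hMfix] at h1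
    obtain ⟨σ, hσ⟩ := h1
    refine ⟨σ, ?_⟩
    ext y
    rw [ht, hσ]; rfl
  refine ⟨L, inferInstance, inferInstance, Ls, inferInstance, inferInstance, hscL, inferInstance,
    htow, inferInstance, inferInstance, Li, R, hR, ?_, hiInf,
    ?_, ?_, ?_⟩
  · obtain ⟨m, hm, htr⟩ := htr
    have h0 : Algebra.trdeg L Ls = 0 := trdeg_eq_zero
    have h1 := trdeg_add_eq K L (A := Ls)
    rw [h0, add_zero, htr] at h1
    obtain ⟨S, hS⟩ := exists_isTranscendenceBasis K L
    have h2 := hS.cardinalMk_eq_trdeg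
    rw [h1] at h2
    have hfin : S.Finite := Cardinal.lt_aleph0_iff_set_finite.1 (h2 ▸ Cardinal.natCast_lt_aleph0)
    lift S to Finset L using hfin
    refine ⟨S, ?_, hS⟩
    rw [Finset.nonempty_iff_ne_empty]
    rintro rfl
    rw [Finset.coe_empty, Cardinal.mk_eq_zero] at h2
    exact hm.ne (by exact_mod_cast h2)
  · rintro i _ ⟨y, hy, rfl⟩
    refine (hmemLi i _).2 fun σ => ?_
    rw [hs1]
    exact congrArg _ ((IntermediateField.mem_fixingSubgroup_iff _ _).1 σ.2 y hy)
  · intro i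
    refine ⟨?_, ?_, ?_⟩
    · intro τ hτ
      obtain ⟨σ, rfl⟩ := htsurj i τ hτ
      rw [hRt]; exact σ.2
    · intro τ hτ τ' hτ' h
      obtain ⟨σ, rfl⟩ := htsurj i τ hτ
      obtain ⟨σ', rfl⟩ := htsurj i τ' hτ'
      rw [hRt, hRt] at h
      rw [Subtype.ext h]
    · intro σ hσ
      exact ⟨t i ⟨σ, hσ⟩, htfix _ _, hRt _ _⟩
  · -- the homomorphism
    let U : Subgroup (Ls ≃ₐ[L] Ls) :=
      { carrier := {σ | ∃ b, (∀ b', σ (x b') = x (b * b')) ∧ φ (R σ) = ψ b}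
        one_mem' := ⟨1, by simp⟩
        mul_mem' := by
          rintro σ τ ⟨b, hb, hb'⟩ ⟨d, hd, hd'⟩
          exact ⟨b * d, fun b' => by rw [AlgEquiv.mul_apply, hd, hb, mul_assoc],
            by simp [hb', hd']⟩
        inv_mem' := by
          rintro σ ⟨b, hb, hb'⟩
          refine ⟨b⁻¹, fun b' => ?_, by simp [hb']⟩
          have := hb (b⁻¹ * b')
          rw [mul_inv_cancel_left] at this
          rw [← this]
          exact σ.symm_apply_apply _ }
    have hRcont : Continuous R := by
      apply continuous_of_continuousAt_one
      rw [ContinuousAt, map_one]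
      intro V hV
      obtain ⟨E, hE, hEV⟩ := (krullTopology_mem_nhds_one_iff K Ks V).1 hV
      let bs := Module.finBasis K E
      have hop : IsOpen (⋂ k, (MulAction.stabilizer (Ls ≃ₐ[L] Ls)
          (algebraMap Ks Ls (bs k)) : Set (Ls ≃ₐ[L] Ls))) :=
        isOpen_iInter_of_finite fun k => stabilizer_isOpen_of_isIntegral _
      refine Filter.mem_map.2 (Filter.mem_of_superset (hop.mem_nhds (by simp)) ?_)
      intro σ hσ
      refine hEV ((IntermediateField.mem_fixingSubgroup_iff _ _).2 fun y hy => ?_)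
      have hlin : (R σ).toLinearMap ∘ₗ E.val.toLinearMap = E.val.toLinearMap := by
        refine bs.ext fun k => ?_
        apply (algebraMap Ks Ls).injective
        exact (hR σ (bs k)).trans (Set.mem_iInter.1 hσ k)
      exact LinearMap.congr_fun hlin ⟨y, hy⟩
    have hUopen : IsOpen (U : Set (Ls ≃ₐ[L] Ls)) := by
      apply Subgroup.isOpen_of_mem_nhds (g := 1)
      have h1 : IsOpen ((fun σ => φ (R σ)) ⁻¹' {1}) :=
        (isOpen_discrete _).preimage (hφcont.comp hRcont)
      have h2 : IsOpen (⋂ b, (MulAction.stabilizer (Ls ≃ₐ[L] Ls) (x b) : Set (Ls ≃ₐ[L] Ls))) :=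
        isOpen_iInter_of_finite fun b => stabilizer_isOpen_of_isIntegral (x b)
      refine Filter.mem_of_superset ((h1.inter h2).mem_nhds ⟨by simp, by simp⟩) ?_
      rintro σ ⟨hσ1, hσ2⟩
      refine ⟨1, fun b => ?_, by rw [map_one]; exact hσ1⟩
      rw [one_mul]
      exact Set.mem_iInter.1 hσ2 b
    have hUtop : U = ⊤ := by
      have hUcl : IsClosed (U : Set (Ls ≃ₐ[L] Ls)) := Subgroup.isClosed_of_isOpen _ hUopen
      have h1 : (IntermediateField.fixedField U).fixingSubgroup = U :=
        InfiniteGalois.fixingSubgroup_fixedField ⟨U, hUcl⟩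
      have h2 : IntermediateField.fixedField U = ⊥ := by
        rw [eq_bot_iff, ← hiInf]
        refine le_iInf fun i y hy => (hmemLi i y).2 fun σ => ?_
        rw [IntermediateField.mem_fixedField_iff] at hy
        refine hy (t i σ) ⟨c i σ, fun b' => ?_, ?_⟩
        · rw [ht, hs2]
        · rw [hRt, hc]
      rw [h2, IntermediateField.fixingSubgroup_bot] at h1
      exact h1.symm
    have hU : ∀ σ : Ls ≃ₐ[L] Ls, ∃ b, (∀ b', σ (x b') = x (b * b')) ∧ φ (R σ) = ψ b := by
      intro σ
      have : σ ∈ U := hUtop ▸ Subgroup.mem_top σ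
      exact this
    choose g hg1 hg2 using hU
    have hguniq : ∀ σ b, σ (x 1) = x b → g σ = b := by
      intro σ b h
      rw [hg1, mul_one] at h
      exact hx h
    let γ : (Ls ≃ₐ[L] Ls) →* B :=
      { toFun := g
        map_one' := hguniq _ _ rfl
        map_mul' := fun σ τ => hguniq _ _ (by rw [AlgEquiv.mul_apply, hg1 τ, hg1 σ, mul_one]) }
    have hγt : ∀ i σ, γ (t i σ) = c i σ := by
      intro i σ
      exact hguniq _ _ (by rw [ht, hs2, mul_one])
    have hmap : ∀ i, Subgroup.map γ ((Li i).fixingSubgroup) = Bi i := by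
      intro i
      apply le_antisymm
      · rintro _ ⟨τ, hτ, rfl⟩
        obtain ⟨σ, rfl⟩ := htsurj i τ hτ
        rw [hγt]; exact hcB i σ
      · intro b hb
        obtain ⟨σ, hσ, h⟩ := (hBiso i).mapsTo hb
        refine ⟨t i ⟨σ, hσ⟩, htfix _ _, ?_⟩
        rw [hγt]
        exact (hBiso i).injOn (hcB i _) hb (by rw [hc, ← h])
    refine ⟨γ, ?_, ?_, fun σ => (hg2 σ).symm, hmap⟩
    · apply continuous_of_continuousAt_one
      rw [ContinuousAt, map_one]
      intro V hV
      refine Filter.mem_map.2 (Filter.mem_of_superset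
        ((stabilizer_isOpen_of_isIntegral (K := L) (x 1)).mem_nhds (one_mem _)) ?_)
      intro σ hσ
      have : γ σ = 1 := hguniq _ _ hσ
      show γ σ ∈ V
      rw [this]
      exact mem_of_mem_nhds hV
    · rw [← MonoidHom.range_eq_top, eq_top_iff, ← hBgen]
      exact iSup_le fun i => by rw [← hmap i]; exact Subgroup.map_le_range _ _

end Stmt17

theorem stmt17 {n : ℕ} (K : Type) [Field K]
    (Ks : Type) [Field Ks] [Algebra K Ks] [IsSepClosure K Ks]
    -- `K_1, …, K_n` are separable algebraic extensions of `K` with `⋂ K_i = K`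
    (Ki : Fin n → IntermediateField K Ks) (hK : ⨅ i, Ki i = ⊥)
    -- a finite embedding problem for `(G(K), G(K_1), …, G(K_n))`
    (A B : Type) [Group A] [Finite A] [TopologicalSpace A] [DiscreteTopology A]
    [Group B] [Finite B] [TopologicalSpace B] [DiscreteTopology B]
    (φ : (Ks ≃ₐ[K] Ks) →* A) (hφcont : Continuous φ) (hφsurj : Function.Surjective φ)
    (ψ : B →* A) (hψsurj : Function.Surjective ψ)
    (Bi : Fin n → Subgroup B) (hBgen : ⨆ i, Bi i = ⊤)
    (hBiso : ∀ i, Set.BijOn ψ (Bi i : Set B) (φ '' ((Ki i).fixingSubgroup : Set (Ks ≃ₐ[K] Ks)))) :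
    ∃ (L : Type) (_ : Field L) (_ : Algebra K L)
      (Ls : Type) (_ : Field Ls) (_ : Algebra L Ls) (_ : IsSepClosure L Ls)
      (_ : Algebra K Ls) (_ : IsScalarTower K L Ls)
      (_ : Algebra Ks Ls) (_ : IsScalarTower K Ks Ls)
      (Li : Fin n → IntermediateField L Ls)
      (R : (Ls ≃ₐ[L] Ls) →* (Ks ≃ₐ[K] Ks)),
      -- `R` is the restriction map `res : G(L) → G(K)`
      (∀ (σ : Ls ≃ₐ[L] Ls) (x : Ks), algebraMap Ks Ls (R σ x) = σ (algebraMap Ks Ls x)) ∧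
      -- (2a) `L/K` has positive finite transcendence degree
      (∃ s : Finset L, s.Nonempty ∧
        IsTranscendenceBasis K (Subtype.val : ((s : Set L)) → L)) ∧
      -- (2b) the `L_i` are separable algebraic over `L` with `⋂ L_i = L`
      (⨅ i, Li i) = ⊥ ∧
      -- (2c) `K_i ⊆ L_i` and `res : G(L_i) → G(K_i)` is a bijection
      (∀ i, algebraMap Ks Ls '' (Ki i : Set Ks) ⊆ (Li i : Set Ls)) ∧
      (∀ i, Set.BijOn R ((Li i).fixingSubgroup : Set (Ls ≃ₐ[L] Ls))
        ((Ki i).fixingSubgroup : Set (Ks ≃ₐ[K] Ks))) ∧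
      -- (2d) a continuous epimorphism `γ : G(L) → B` with `ψ ∘ γ = φ ∘ res` and
      -- `γ(G(L_i)) = B_i`
      ∃ γ : (Ls ≃ₐ[L] Ls) →* B, Continuous γ ∧ Function.Surjective γ ∧
        (∀ σ, ψ (γ σ) = φ (R σ)) ∧
        ∀ i, Subgroup.map γ ((Li i).fixingSubgroup) = Bi i := by
  classical
  cases nonempty_fintype B
  let FF : Type := FractionRing (MvPolynomial B Ks)
  let Ls : Type := SeparableClosure FF
  let aK : Algebra K Ls := ((algebraMap Ks Ls).comp (algebraMap K Ks)).toAlgebra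
  have tK : IsScalarTower K Ks Ls := IsScalarTower.of_algebraMap_eq fun _ => rfl
  let Ka : Type := AlgebraicClosure Ks
  have tKa : IsScalarTower K Ks Ka := inferInstance
  obtain ⟨l, hl⟩ := Stmt17.exists_lift_algClosure (K := K) (Ks := Ks) (Ka := Ka)
  let x : B → Ls := Stmt17.xx Ks FF Ls
  have hE : IsSepClosure (Stmt17.EE K x) Ls := Stmt17.isSepClosure_EE (Ks := Ks) (FF := FF)
  have hmain : ∀ i, ∃ (c : (Ki i).fixingSubgroup → B)
      (s : (Ki i).fixingSubgroup →* (Ls ≃ₐ[Stmt17.EE K x] Ls)),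
      (∀ σ, c σ ∈ Bi i) ∧ (∀ σ, ψ (c σ) = φ σ) ∧ Continuous s ∧
      (∀ σ a, s σ (algebraMap Ks Ls a) = algebraMap Ks Ls ((σ : Ks ≃ₐ[K] Ks) a)) ∧
      (∀ σ b, s σ (x b) = x (c σ * b)) := by
    intro i
    obtain ⟨u, c, hu, hcB, hc, huc⟩ :=
      Stmt17.exists_u φ hφcont ψ (Ki i).fixingSubgroup (Bi i) (hBiso i) l hl
    obtain ⟨j, hj1, hj2⟩ := Stmt17.exists_j (Ks := Ks) (FF := FF) (Ls := Ls) u hu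
    have hjx : ∀ (σ : (Ki i).fixingSubgroup) b,
        Stmt17.hahnMap (l σ : Ka ≃+* Ka) (j (x b)) = j (x (c σ * b)) := by
      intro σ b
      rw [hj2, hj2, huc]
    obtain ⟨s, h1, h2, h3⟩ := Stmt17.core (E0 := Stmt17.EE K x) l hl (Ki i).fixingSubgroup x c j
      hj1 hjx (fun σ e => by
        refine Stmt17.fix_EE x j
          ((Stmt17.hahnMap (l σ : Ka ≃+* Ka)) : HahnSeries ℝ Ka →+* HahnSeries ℝ Ka)
          (c σ) (hjx σ) (fun a => ?_) e
        have h := hj1 (algebraMap K Ks a)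
        rw [← IsScalarTower.algebraMap_apply K Ks Ls] at h
        rw [h]
        refine (Stmt17.hahnMap_single _ _ _).trans ?_
        rw [AlgEquiv.coe_ringEquiv, hl, AlgEquiv.commutes])
    exact ⟨c, s, hcB, hc, h1, h2, h3⟩
  choose c s hcB hc h1 h2 h3 using hmain
  exact Stmt17.assembly Ki φ hφcont ψ Bi hBgen hBiso (E0 := Stmt17.EE K x) (Ls := Ls)
    ⟨Fintype.card B, Fintype.card_pos, Stmt17.trdeg_Ls K Ks FF Ls B⟩ x
    Stmt17.xx_injective c hcB hc s h1 h2 h3
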